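/- arXiv:2010.10730 — 2 statements merged into one kernel-verified Lean document; each statement's English description precedes it below -/
import Mathlib

section
/- Let N ≥ 1, ε > 0, λ ∈ ℝ, p > 1, and let V : ℝ^N → ℝ be continuously differentiable. Let ψ : ℝ × ℝ^N → ℂ be three times continuously differentiable on a neighborhood of a point (t₀,x₀), satisfy iε ∂_t ψ = −ε² Δ_x ψ + V ψ − λ |ψ|^{p−1} ψ on that neighborhood, and assume ψ(t₀,x₀) ≠ 0. Then at (t₀,x₀), for every 1 ≤ m ≤ N: ε ∂_t Im( \overline{ψ} ∂_{x_m} ψ ) = −(∂_{x_m} V) |ψ|² + ε² [ (1/2) ∂_{x_m} Δ_x (|ψ|²) − 2 ∑_{n=1}^N ∂_{x_n} Re( \overline{∂_{x_n} ψ} ∂_{x_m} ψ ) ] + λ ((p−1)/(p+1)) ∂_{x_m} ( |ψ|^{p+1} ). (Transport formula for momentum, equation (3-10), with the stress tensor written out explicitly.) -/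
open MeasureTheory

variable {N : ℕ}

/-- Partial derivative of a complex-valued function in the m-th coordinate direction. -/
noncomputable def pdC (f : EuclideanSpace ℝ (Fin N) → ℂ) (m : Fin N)
    (x : EuclideanSpace ℝ (Fin N)) : ℂ :=
  fderiv ℝ f x (EuclideanSpace.single m 1)

/-- Partial derivative of a real-valued function in the m-th coordinate direction. -/
noncomputable def pdR (f : EuclideanSpace ℝ (Fin N) → ℝ) (m : Fin N)
    (x : EuclideanSpace ℝ (Fin N)) : ℝ :=
  fderiv ℝ f x (EuclideanSpace.single m 1)

/-- Laplacian of a real-valued function, as the sum of second partial derivatives. -/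
noncomputable def lapR (f : EuclideanSpace ℝ (Fin N) → ℝ)
    (x : EuclideanSpace ℝ (Fin N)) : ℝ :=
  ∑ m : Fin N, pdR (fun y => pdR f m y) m x

/-- Laplacian of a complex-valued function, as the sum of second partial derivatives. -/
noncomputable def lapC (f : EuclideanSpace ℝ (Fin N) → ℂ)
    (x : EuclideanSpace ℝ (Fin N)) : ℂ :=
  ∑ m : Fin N, pdC (fun y => pdC f m y) m x

open Filter Topology

lemma pdC_contDiffAt {f : EuclideanSpace ℝ (Fin N) → ℂ} {x : EuclideanSpace ℝ (Fin N)} (k j : ℕ)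
    (hf : ContDiffAt ℝ k f x) (hjk : j + 1 ≤ k) (m : Fin N) :
    ContDiffAt ℝ j (fun y => pdC f m y) x := by
  unfold pdC
  have h := hf.fderiv_right (m := (j : WithTop ℕ∞)) (by exact_mod_cast hjk)
  exact h.clm_apply contDiffAt_const

lemma hasFDerivAt_re_mul {f g : EuclideanSpace ℝ (Fin N) → ℂ} {x : EuclideanSpace ℝ (Fin N)}
    (hf : DifferentiableAt ℝ f x) (hg : DifferentiableAt ℝ g x) :
    ∃ L : EuclideanSpace ℝ (Fin N) →L[ℝ] ℝ,
      HasFDerivAt (fun y => ((starRingEnd ℂ) (f y) * g y).re) L x ∧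
      ∀ m, L (EuclideanSpace.single m 1) = ((starRingEnd ℂ) (pdC f m x) * g x +
      (starRingEnd ℂ) (f x) * pdC g m x).re := by
  have h1 : HasFDerivAt (fun y => (starRingEnd ℂ) (f y))
      ((Complex.conjCLE : ℂ →L[ℝ] ℂ).comp (fderiv ℝ f x)) x :=
    (Complex.conjCLE : ℂ →L[ℝ] ℂ).hasFDerivAt.comp x hf.hasFDerivAt
  have h2 := h1.mul hg.hasFDerivAt
  have h3 := (Complex.reCLM).hasFDerivAt.comp x h2
  refine ⟨_, h3, fun m => ?_⟩
  simp [pdC]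
  ring

lemma pdR_re_mul {f g : EuclideanSpace ℝ (Fin N) → ℂ} {x : EuclideanSpace ℝ (Fin N)}
    (hf : DifferentiableAt ℝ f x) (hg : DifferentiableAt ℝ g x) (m : Fin N) :
    pdR (fun y => ((starRingEnd ℂ) (f y) * g y).re) m x =
      ((starRingEnd ℂ) (pdC f m x) * g x + (starRingEnd ℂ) (f x) * pdC g m x).re := by
  obtain ⟨L, hL, h⟩ := hasFDerivAt_re_mul hf hg
  rw [pdR, hL.fderiv, h]

lemma diffAt_re_mul {f g : EuclideanSpace ℝ (Fin N) → ℂ} {x : EuclideanSpace ℝ (Fin N)}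
    (hf : DifferentiableAt ℝ f x) (hg : DifferentiableAt ℝ g x) :
    DifferentiableAt ℝ (fun y => ((starRingEnd ℂ) (f y) * g y).re) x := by
  obtain ⟨L, hL, -⟩ := hasFDerivAt_re_mul hf hg
  exact hL.differentiableAt

lemma pdR_congr {f g : EuclideanSpace ℝ (Fin N) → ℝ} {x : EuclideanSpace ℝ (Fin N)}
    (h : f =ᶠ[𝓝 x] g) (m : Fin N) : pdR f m x = pdR g m x := by
  rw [pdR, pdR, h.fderiv_eq]

lemma pdC_congr {f g : EuclideanSpace ℝ (Fin N) → ℂ} {x : EuclideanSpace ℝ (Fin N)}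
    (h : f =ᶠ[𝓝 x] g) (m : Fin N) : pdC f m x = pdC g m x := by
  rw [pdC, pdC, h.fderiv_eq]

lemma normSq_eq_re (z : ℂ) : ‖z‖ ^ 2 = ((starRingEnd ℂ) z * z).re := by
  rw [← Complex.normSq_eq_norm_sq, Complex.normSq_apply]; simp

lemma pdC_symm {f : EuclideanSpace ℝ (Fin N) → ℂ} {x : EuclideanSpace ℝ (Fin N)}
    (hf : ContDiffAt ℝ 2 f x) (m n : Fin N) :
    pdC (fun y => pdC f m y) n x = pdC (fun y => pdC f n y) m x := by
  have hs : IsSymmSndFDerivAt ℝ f x := hf.isSymmSndFDerivAt (by simp)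
  have hd : DifferentiableAt ℝ (fderiv ℝ f) x :=
    (hf.fderiv_right (m := 1) (by norm_num)).differentiableAt (by norm_num)
  have key : ∀ a b : Fin N, pdC (fun y => pdC f a y) b x =
      fderiv ℝ (fderiv ℝ f) x (EuclideanSpace.single b 1) (EuclideanSpace.single a 1) := by
    intro a b
    unfold pdC
    rw [fderiv_clm_apply hd (differentiableAt_const _)]
    simp
  rw [key, key]
  exact hs.eq _ _

/-- Second derivative of the density. -/
lemma pdR_pdR_normSq {f : EuclideanSpace ℝ (Fin N) → ℂ} {x : EuclideanSpace ℝ (Fin N)}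
    (hf : ContDiffAt ℝ 2 f x) (n : Fin N) :
    pdR (fun y => pdR (fun z => ‖f z‖ ^ 2) n y) n x =
      2 * ((starRingEnd ℂ) (pdC f n x) * pdC f n x).re
      + 2 * ((starRingEnd ℂ) (f x) * pdC (fun y => pdC f n y) n x).re := by
  have hd : DifferentiableAt ℝ f x := hf.differentiableAt (by norm_num)
  have hd1 : DifferentiableAt ℝ (fun y => pdC f n y) x :=
    (pdC_contDiffAt 2 1 hf le_rfl n).differentiableAt (by norm_num)
  have h1 : (fun y => pdR (fun z => ‖f z‖ ^ 2) n y) =ᶠ[𝓝 x]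
      fun y => ((starRingEnd ℂ) (f y) * (2 * pdC f n y)).re := by
    filter_upwards [hf.eventually (by simp)] with y hy
    have hy' : DifferentiableAt ℝ f y := hy.differentiableAt (by norm_num)
    simp_rw [normSq_eq_re]
    rw [pdR_re_mul hy' hy']
    simp
    ring
  rw [pdR_congr h1, pdR_re_mul hd (hd1.const_mul 2)]
  have : pdC (fun y => 2 * pdC f n y) n x = 2 * pdC (fun y => pdC f n y) n x := by
    conv_lhs => rw [pdC, fderiv_const_mul hd1]
    simp [pdC]
  rw [this]
  simp
  ring

lemma pdR_lap_normSq {f : EuclideanSpace ℝ (Fin N) → ℂ} {x : EuclideanSpace ℝ (Fin N)}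
    (hf : ContDiffAt ℝ 3 f x) (m : Fin N) :
    pdR (fun y => lapR (fun z => ‖f z‖ ^ 2) y) m x =
      ∑ n, (4 * ((starRingEnd ℂ) (pdC f n x) * pdC (fun y => pdC f n y) m x).re
      + 2 * ((starRingEnd ℂ) (pdC f m x) * pdC (fun y => pdC f n y) n x).re
      + 2 * ((starRingEnd ℂ) (f x) *
          pdC (fun w => pdC (fun y => pdC f n y) n w) m x).re) := by
  have hd : DifferentiableAt ℝ f x := hf.differentiableAt (by norm_num)
  have hc1 : ∀ n, ContDiffAt ℝ 2 (fun y => pdC f n y) x := fun n =>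
    pdC_contDiffAt 3 2 hf le_rfl n
  have hd1 : ∀ n, DifferentiableAt ℝ (fun y => pdC f n y) x := fun n =>
    (hc1 n).differentiableAt (by norm_num)
  have hd2 : ∀ n, DifferentiableAt ℝ (fun w => pdC (fun y => pdC f n y) n w) x := fun n =>
    (pdC_contDiffAt 2 1 (hc1 n) le_rfl n).differentiableAt (by norm_num)
  have h1 : (fun y => lapR (fun z => ‖f z‖ ^ 2) y) =ᶠ[𝓝 x] fun w =>
      ∑ n, (2 * ((starRingEnd ℂ) (pdC f n w) * pdC f n w).re
      + 2 * ((starRingEnd ℂ) (f w) * pdC (fun y => pdC f n y) n w).re) := by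
    filter_upwards [hf.eventually (by simp)] with y hy
    unfold lapR
    exact Finset.sum_congr rfl fun n _ => pdR_pdR_normSq (hy.of_le (by norm_num)) n
  rw [pdR_congr h1, pdR, fderiv_fun_sum, ContinuousLinearMap.sum_apply]
  · refine Finset.sum_congr rfl fun n _ => ?_
    rw [fderiv_fun_add ((diffAt_re_mul (hd1 n) (hd1 n)).const_mul 2)
      ((diffAt_re_mul hd (hd2 n)).const_mul 2),
      fderiv_const_mul (diffAt_re_mul (hd1 n) (hd1 n)),
      fderiv_const_mul (diffAt_re_mul hd (hd2 n))]
    have e1 := pdR_re_mul (hd1 n) (hd1 n) m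
    have e2 := pdR_re_mul hd (hd2 n) m
    unfold pdR at e1 e2
    simp only [ContinuousLinearMap.add_apply, ContinuousLinearMap.smul_apply, smul_eq_mul]
    rw [e1, e2]
    simp
    ring
  · intro n _
    exact ((diffAt_re_mul (hd1 n) (hd1 n)).const_mul 2).add
      ((diffAt_re_mul hd (hd2 n)).const_mul 2)

/-- The time derivative of the momentum density. -/
lemma time_deriv {ψ : ℝ × EuclideanSpace ℝ (Fin N) → ℂ} {t : ℝ} {x : EuclideanSpace ℝ (Fin N)}
    (hψ : ContDiffAt ℝ 3 ψ (t, x)) (m : Fin N) :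
    deriv (fun u => ((starRingEnd ℂ) (ψ (u, x)) * pdC (fun y => ψ (u, y)) m x).im) t =
      ((starRingEnd ℂ) (deriv (fun u => ψ (u, x)) t) * pdC (fun y => ψ (t, y)) m x +
       (starRingEnd ℂ) (ψ (t, x)) * pdC (fun y => deriv (fun u => ψ (u, y)) t) m x).im := by
  have hA : ∀ q : ℝ × EuclideanSpace ℝ (Fin N), HasDerivAt (fun u : ℝ => (u, q.2)) ((1 : ℝ), (0 : EuclideanSpace ℝ (Fin N))) q.1 :=
    fun q => (hasDerivAt_id q.1).prodMk (hasDerivAt_const _ _)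
  have hB : ∀ q : ℝ × EuclideanSpace ℝ (Fin N), HasFDerivAt (fun y => (q.1, y))
      (ContinuousLinearMap.inr ℝ ℝ (EuclideanSpace ℝ (Fin N))) q.2 :=
    fun q => hasFDerivAt_prodMk_right q.1 q.2
  have hAq : ∀ q : ℝ × EuclideanSpace ℝ (Fin N), ∀ f : ℝ × EuclideanSpace ℝ (Fin N) → ℂ,
      DifferentiableAt ℝ f q →
      HasDerivAt (fun u => f (u, q.2)) (fderiv ℝ f q (1, 0)) q.1 := fun q f hf =>
    HasFDerivAt.comp_hasDerivAt (f := fun u : ℝ => (u, q.2)) q.1 hf.hasFDerivAt (hA q)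
  have hBq : ∀ q : ℝ × EuclideanSpace ℝ (Fin N), ∀ f : ℝ × EuclideanSpace ℝ (Fin N) → ℂ,
      DifferentiableAt ℝ f q →
      pdC (fun y => f (q.1, y)) m q.2 = fderiv ℝ f q (0, EuclideanSpace.single m 1) := by
    intro q f hf
    have := HasFDerivAt.comp (f := fun y => (q.1, y)) q.2 hf.hasFDerivAt (hB q)
    have h2 := this.fderiv
    unfold pdC
    simp only [Function.comp_def] at h2
    rw [h2]
    simp
  have hd : DifferentiableAt ℝ ψ (t, x) := hψ.differentiableAt (by norm_num)
  have hdd : DifferentiableAt ℝ (fderiv ℝ ψ) (t, x) :=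
    (hψ.fderiv_right (m := 1) (by norm_num)).differentiableAt (by norm_num)
  have hev : ∀ᶠ q in 𝓝 (t, x), DifferentiableAt ℝ ψ q := by
    filter_upwards [hψ.eventually (by simp)] with y hy
    exact hy.differentiableAt (by norm_num)
  have hevt : ∀ᶠ u in 𝓝 t, DifferentiableAt ℝ ψ (u, x) :=
    (Continuous.tendsto (f := fun u : ℝ => (u, x)) (by fun_prop) t).eventually hev
  have hevx : ∀ᶠ y in 𝓝 x, DifferentiableAt ℝ ψ (t, y) :=
    (Continuous.tendsto (f := fun y => (t, y)) (by fun_prop) x).eventually hev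
  have hs : IsSymmSndFDerivAt ℝ ψ (t, x) := hψ.isSymmSndFDerivAt (by simp; norm_num)
  have hdv : ∀ v, DifferentiableAt ℝ (fun q => fderiv ℝ ψ q v) (t, x) := fun v =>
    hdd.clm_apply (differentiableAt_const _)
  have key : ∀ v w, fderiv ℝ (fun q => fderiv ℝ ψ q v) (t, x) w =
      fderiv ℝ (fderiv ℝ ψ) (t, x) w v := by
    intro v w
    rw [fderiv_clm_apply hdd (differentiableAt_const _)]
    simp
  have e1 : pdC (fun y => deriv (fun u => ψ (u, y)) t) m x =
      fderiv ℝ (fderiv ℝ ψ) (t, x) (0, EuclideanSpace.single m 1) (1, 0) := by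
    rw [← key, ← hBq (t, x) _ (hdv _)]
    apply pdC_congr
    filter_upwards [hevx] with y hy
    exact (hAq (t, y) ψ hy).deriv
  have h2 : HasDerivAt (fun u => pdC (fun y => ψ (u, y)) m x)
      (pdC (fun y => deriv (fun u => ψ (u, y)) t) m x) t := by
    have h3 := hAq (t, x) _ (hdv (0, EuclideanSpace.single m 1))
    rw [key, hs.eq, ← e1] at h3
    refine h3.congr_of_eventuallyEq ?_
    filter_upwards [hevt] with u hu
    exact hBq (u, x) ψ hu
  have h1 := hAq (t, x) ψ hd
  rw [← h1.deriv] at h1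
  have h1' : HasDerivAt (fun u => (starRingEnd ℂ) (ψ (u, x)))
      ((starRingEnd ℂ) (deriv (fun u => ψ (u, x)) t)) t :=
    (Complex.conjCLE : ℂ →L[ℝ] ℂ).hasFDerivAt.comp_hasDerivAt t h1
  exact (Complex.imCLM.hasFDerivAt.comp_hasDerivAt t (h1'.mul h2)).deriv

/-- transport formula for momentum, equation (3-10), with the stress tensor
written out explicitly. -/
theorem momentum_transport (hN : 1 ≤ N) (ε lam p : ℝ) (hε : 0 < ε) (hp : 1 < p)
    (V : EuclideanSpace ℝ (Fin N) → ℝ) (hV : ContDiff ℝ 1 V)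
    (ψ : ℝ × EuclideanSpace ℝ (Fin N) → ℂ)
    (t₀ : ℝ) (x₀ : EuclideanSpace ℝ (Fin N))
    (s : Set (ℝ × EuclideanSpace ℝ (Fin N))) (hs : IsOpen s) (hmem : (t₀, x₀) ∈ s)
    (hψ : ContDiffOn ℝ 3 ψ s)
    (heq : ∀ q ∈ s,
      Complex.I * (ε : ℂ) * deriv (fun u => ψ (u, q.2)) q.1 =
        -(ε : ℂ) ^ 2 * lapC (fun y => ψ (q.1, y)) q.2 + (V q.2 : ℂ) * ψ q -
          (lam : ℂ) * ((‖ψ q‖ ^ (p - 1) : ℝ) : ℂ) * ψ q)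
    (hne : ψ (t₀, x₀) ≠ 0) :
    ∀ m : Fin N,
      ε * deriv
          (fun u => ((starRingEnd ℂ) (ψ (u, x₀)) * pdC (fun y => ψ (u, y)) m x₀).im) t₀ =
        -(pdR V m x₀) * ‖ψ (t₀, x₀)‖ ^ 2 +
          ε ^ 2 *
            (1 / 2 * pdR (fun y => lapR (fun z => ‖ψ (t₀, z)‖ ^ 2) y) m x₀ -
              2 * ∑ n : Fin N,
                pdR
                  (fun y =>
                    ((starRingEnd ℂ) (pdC (fun z => ψ (t₀, z)) n y) *
                      pdC (fun z => ψ (t₀, z)) m y).re)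
                  n x₀) +
          lam * ((p - 1) / (p + 1)) * pdR (fun y => ‖ψ (t₀, y)‖ ^ (p + 1)) m x₀ := by
  intro m
  have hcd : ContDiffAt ℝ 3 ψ (t₀, x₀) := hψ.contDiffAt (hs.mem_nhds hmem)
  rw [time_deriv hcd m]
  set φ : EuclideanSpace ℝ (Fin N) → ℂ := fun y => ψ (t₀, y) with hφdef
  have hφ : ContDiffAt ℝ 3 φ x₀ :=
    ContDiffAt.comp (f := fun y => (t₀, y)) x₀ hcd (by fun_prop)
  have hφ0 : ψ (t₀, x₀) = φ x₀ := rfl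
  have hd : DifferentiableAt ℝ φ x₀ := hφ.differentiableAt (by norm_num)
  have hc1 : ∀ n, ContDiffAt ℝ 2 (fun y => pdC φ n y) x₀ := fun n =>
    pdC_contDiffAt 3 2 hφ le_rfl n
  have hd1 : ∀ n, DifferentiableAt ℝ (fun y => pdC φ n y) x₀ := fun n =>
    (hc1 n).differentiableAt (by norm_num)
  have hd2 : ∀ n, DifferentiableAt ℝ (fun w => pdC (fun y => pdC φ n y) n w) x₀ := fun n =>
    (pdC_contDiffAt 2 1 (hc1 n) le_rfl n).differentiableAt (by norm_num)
  have hne' : φ x₀ ≠ 0 := hne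
  have hεC : (ε : ℂ) ≠ 0 := by exact_mod_cast hε.ne'
  -- powers of the modulus
  have hr : DifferentiableAt ℝ (fun y => ‖φ y‖) x₀ := hd.norm ℝ hne'
  have hrpos : 0 < ‖φ x₀‖ := norm_pos_iff.mpr hne'
  set rm : ℝ := pdR (fun y => ‖φ y‖) m x₀ with hrm
  have hpow : ∀ q : ℝ, HasFDerivAt (fun y => ‖φ y‖ ^ q)
      ((q * ‖φ x₀‖ ^ (q - 1)) • fderiv ℝ (fun y => ‖φ y‖) x₀) x₀ := fun q =>
    hr.hasFDerivAt.rpow_const (Or.inl hrpos.ne')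
  have hpd : pdR (fun y => ‖φ y‖ ^ (p + 1)) m x₀ = (p + 1) * ‖φ x₀‖ ^ p * rm := by
    rw [pdR, (hpow (p + 1)).fderiv]
    simp [hrm, pdR]
  set W : EuclideanSpace ℝ (Fin N) → ℝ := fun y => V y - lam * ‖φ y‖ ^ (p - 1) with hW
  have hVd : DifferentiableAt ℝ V x₀ := hV.differentiable (by norm_num) x₀
  have hWd : HasFDerivAt W (fderiv ℝ V x₀ - lam • (((p - 1) * ‖φ x₀‖ ^ (p - 1 - 1)) •
      fderiv ℝ (fun y => ‖φ y‖) x₀)) x₀ :=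
    hVd.hasFDerivAt.sub ((hpow (p - 1)).const_mul lam)
  have hWC : HasFDerivAt (fun y => (W y : ℂ)) (Complex.ofRealCLM.comp (fderiv ℝ V x₀ - lam •
      (((p - 1) * ‖φ x₀‖ ^ (p - 1 - 1)) • fderiv ℝ (fun y => ‖φ y‖) x₀))) x₀ :=
    Complex.ofRealCLM.hasFDerivAt.comp x₀ hWd
  have hτ : ∀ y, (t₀, y) ∈ s → deriv (fun u => ψ (u, y)) t₀ =
      (ε : ℂ)⁻¹ * Complex.I * ((ε : ℂ) ^ 2 * lapC φ y - (W y : ℂ) * φ y) := by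
    intro y hy
    have h := heq (t₀, y) hy
    simp only at h
    have hI := Complex.I_mul_I
    rw [mul_assoc, eq_comm, inv_mul_eq_iff_eq_mul₀ hεC, hW]
    push_cast
    change _ = -(ε : ℂ) ^ 2 * lapC φ y + (V y : ℂ) * φ y - lam * ((‖φ y‖ ^ (p - 1) : ℝ) : ℂ) * φ y at h
    linear_combination Complex.I * h - (ε : ℂ) * deriv (fun u => ψ (u, y)) t₀ * hI
  have hτ0 := hτ x₀ hmem
  have hτev : (fun y => deriv (fun u => ψ (u, y)) t₀) =ᶠ[𝓝 x₀] fun y =>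
      (ε : ℂ)⁻¹ * Complex.I * ((ε : ℂ) ^ 2 * lapC φ y - (W y : ℂ) * φ y) := by
    have : ∀ᶠ y in 𝓝 x₀, (t₀, y) ∈ s :=
      (Continuous.tendsto (f := fun y => (t₀, y)) (by fun_prop) x₀).eventually
        (hs.mem_nhds hmem)
    filter_upwards [this] with y hy using hτ y hy
  have hlap : HasFDerivAt (fun y => lapC φ y)
      (∑ n, fderiv ℝ (fun w => pdC (fun y => pdC φ n y) n w) x₀) x₀ := by
    unfold lapC
    exact HasFDerivAt.fun_sum fun n _ => (hd2 n).hasFDerivAt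
  have hτm : pdC (fun y => deriv (fun u => ψ (u, y)) t₀) m x₀ =
      (ε : ℂ)⁻¹ * Complex.I * ((ε : ℂ) ^ 2 *
        (∑ n, pdC (fun w => pdC (fun y => pdC φ n y) n w) m x₀) -
        ((W x₀ : ℂ) * pdC φ m x₀ +
          ((pdR V m x₀ - lam * ((p - 1) * ‖φ x₀‖ ^ (p - 1 - 1) * rm) : ℝ) : ℂ) * φ x₀)) := by
    rw [pdC_congr hτev]
    have h := ((hlap.const_mul ((ε : ℂ) ^ 2)).sub (hWC.mul hd.hasFDerivAt)).const_mul
      ((ε : ℂ)⁻¹ * Complex.I)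
    simp only [Pi.sub_apply, Pi.mul_apply] at h
    rw [pdC, HasFDerivAt.fderiv h]
    simp [pdC, pdR, hrm]
    left
    ring
  have hpp : ‖φ x₀‖ ^ p = ‖φ x₀‖ ^ (p - 1 - 1) * ‖φ x₀‖ ^ 2 := by
    rw [← Real.rpow_natCast, ← Real.rpow_add hrpos]
    congr 1
    push_cast
    ring
  have hsq : ‖φ x₀‖ ^ 2 = (φ x₀).re * (φ x₀).re + (φ x₀).im * (φ x₀).im := by
    rw [normSq_eq_re]; simp
  have hS : ∀ n, pdR (fun y => ((starRingEnd ℂ) (pdC φ n y) * pdC φ m y).re) n x₀ =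
      ((starRingEnd ℂ) (pdC (fun y => pdC φ n y) n x₀) * pdC φ m x₀).re +
      ((starRingEnd ℂ) (pdC φ n x₀) * pdC (fun y => pdC φ n y) m x₀).re := by
    intro n
    rw [pdR_re_mul (hd1 n) (hd1 m) n, pdC_symm (hφ.of_le (by norm_num)) m n, Complex.add_re]
  have hmain : 1 / 2 * pdR (fun y => lapR (fun z => ‖φ z‖ ^ 2) y) m x₀ -
      2 * ∑ n, pdR (fun y => ((starRingEnd ℂ) (pdC φ n y) * pdC φ m y).re) n x₀ =
      ((starRingEnd ℂ) (φ x₀) * ∑ n, pdC (fun w => pdC (fun y => pdC φ n y) n w) m x₀).re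
      - ((starRingEnd ℂ) (lapC φ x₀) * pdC φ m x₀).re := by
    rw [pdR_lap_normSq hφ m]
    simp_rw [hS]
    unfold lapC
    rw [map_sum, Finset.sum_mul]
    simp only [Finset.mul_sum, Complex.re_sum]
    rw [← Finset.sum_sub_distrib, ← Finset.sum_sub_distrib]
    refine Finset.sum_congr rfl fun n _ => ?_
    simp
    ring
  change ε * _ = -(pdR V m x₀) * ‖φ x₀‖ ^ 2 + ε ^ 2 *
    (1 / 2 * pdR (fun y => lapR (fun z => ‖φ z‖ ^ 2) y) m x₀ -
      2 * ∑ n, pdR (fun y => ((starRingEnd ℂ) (pdC φ n y) * pdC φ m y).re) n x₀) +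
    lam * ((p - 1) / (p + 1)) * pdR (fun y => ‖φ y‖ ^ (p + 1)) m x₀
  rw [hmain, hpd, hpp, hτm, hτ0, hφ0]
  have hp1 : p + 1 ≠ 0 := by linarith
  have hfin : lam * ((p - 1) / (p + 1)) *
      ((p + 1) * (‖φ x₀‖ ^ (p - 1 - 1) * ‖φ x₀‖ ^ 2) * rm) =
      lam * ((p - 1) * ‖φ x₀‖ ^ (p - 1 - 1) * rm) * ‖φ x₀‖ ^ 2 := by
    field_simp
  rw [hfin]
  generalize lam * ((p - 1) * ‖φ x₀‖ ^ (p - 1 - 1) * rm) = K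
  rw [hsq]
  generalize (∑ n, pdC (fun w => pdC (fun y => pdC φ n y) n w) m x₀) = L3
  generalize lapC φ x₀ = L
  generalize pdC φ m x₀ = A
  generalize φ x₀ = B
  generalize W x₀ = w
  generalize pdR V m x₀ = v
  have hinv : (ε : ℂ)⁻¹ = ((ε⁻¹ : ℝ) : ℂ) := by push_cast; rfl
  have hsq2 : (ε : ℂ) ^ 2 = ((ε ^ 2 : ℝ) : ℂ) := by push_cast; rfl
  have hmul : ε * ε⁻¹ = 1 := mul_inv_cancel₀ hε.ne'
  rw [hinv, hsq2]
  generalize ε⁻¹ = δ at *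
  simp only [Complex.add_im, Complex.mul_im, Complex.mul_re, Complex.conj_re, Complex.conj_im,
    Complex.sub_re, Complex.sub_im, Complex.ofReal_re, Complex.ofReal_im, Complex.I_re,
    Complex.I_im, Complex.add_re]
  linear_combination (ε ^ 2 * (B.re * L3.re + B.im * L3.im - L.re * A.re - L.im * A.im)
    - (v - K) * (B.re * B.re + B.im * B.im)) * hmul
end

section
/- For every real p > 1 there exists a constant C_p > 0 such that for all complex numbers a, b: | |a+b|^{p+1} − |a|^{p+1} − (p+1) |a|^{p−1} Re( \overline{a} b ) | ≤ C_p ( |a|^{p−1} |b|² + |b|^{p+1} ), where the middle term is interpreted as 0 when a = 0. (This pointwise second-order Taylor bound for z ↦ |z|^{p+1} underlies the remainder estimate |R_η^{(2)}(w)| ≤ C‖w‖²_{H¹} in (3-16).) -/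
lemma tb_conv (s : ℝ) (hs : 1 < s) (x y : ℝ) (hx : 0 ≤ x) (hy : 0 ≤ y) :
    y ^ s - x ^ s ≤ s * y ^ (s - 1) * (y - x) := by
  have hs0 : 0 < s := by linarith
  have h := Real.geom_mean_le_arith_mean2_weighted (w₁ := 1 / s) (w₂ := (s - 1) / s)
    (p₁ := x ^ s) (p₂ := y ^ s) (by positivity) (div_nonneg (by linarith) hs0.le)
    (by positivity) (by positivity) (by field_simp; ring)
  rw [← Real.rpow_mul hx, ← Real.rpow_mul hy] at h
  rw [show s * (1 / s) = 1 by field_simp, show s * ((s - 1) / s) = s - 1 by field_simp,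
    Real.rpow_one] at h
  have e : y ^ s = y ^ (s - 1) * y := by
    conv_rhs => rw [← Real.rpow_add_one' hy (by linarith)]
    congr 1; ring
  have h2 : s * (x * y ^ (s - 1)) ≤ x ^ s + (s - 1) * y ^ s := by
    calc _ ≤ s * (1 / s * x ^ s + (s - 1) / s * y ^ s) := by gcongr
      _ = _ := by field_simp
  have e2 : s * y ^ (s - 1) * (y - x) = s * y ^ s - s * (x * y ^ (s - 1)) := by rw [e]; ring
  linarith

lemma tb_prod (p : ℝ) (hp : 1 < p) (m M : ℝ) (hm : 0 ≤ m) (h : m ≤ M) :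
    (M ^ (p - 1) - m ^ (p - 1)) * (M ^ 2 - m ^ 2) ≤ 2 * p * M ^ (p - 1) * (M - m) ^ 2 := by
  have hM : 0 ≤ M := hm.trans h
  have c := tb_conv p hp m M hm hM
  have e : ∀ y : ℝ, 0 ≤ y → y ^ p = y ^ (p - 1) * y := by
    intro y hy
    conv_rhs => rw [← Real.rpow_add_one' hy (by linarith)]
    congr 1; ring
  rw [e m hm, e M hM] at c
  have hmr : 0 ≤ m ^ (p - 1) := by positivity
  have hle : m ^ (p - 1) ≤ M ^ (p - 1) := Real.rpow_le_rpow hm h (by linarith)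
  have c2 : (M ^ (p - 1) - m ^ (p - 1)) * (M + m) ≤ 2 * (p * M ^ (p - 1) * (M - m)) := by
    nlinarith [mul_nonneg hmr (sub_nonneg.2 h), mul_nonneg (sub_nonneg.2 hle) (sub_nonneg.2 h)]
  nlinarith [mul_le_mul_of_nonneg_right c2 (sub_nonneg.2 h)]

lemma tb_max (r : ℝ) (hr : 0 < r) (X B M : ℝ) (hX : 0 ≤ X) (hB : 0 ≤ B) (hM : 0 ≤ M)
    (h : M ≤ X + B) : M ^ r ≤ 2 ^ r * (X ^ r + B ^ r) := by
  have h1 : 0 ≤ X ^ r := by positivity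
  have h2 : 0 ≤ B ^ r := by positivity
  have h3 : (0:ℝ) ≤ 2 ^ r := by positivity
  rcases le_total X B with k | k
  · have : M ^ r ≤ (2 * B) ^ r := Real.rpow_le_rpow hM (by linarith) hr.le
    rw [Real.mul_rpow (by norm_num) hB] at this
    nlinarith [mul_nonneg h3 h1]
  · have : M ^ r ≤ (2 * X) ^ r := Real.rpow_le_rpow hM (by linarith) hr.le
    rw [Real.mul_rpow (by norm_num) hX] at this
    nlinarith [mul_nonneg h3 h2]

lemma tb_all (p : ℝ) (hp : 1 < p) (X Y B : ℝ) (hX : 0 ≤ X) (hY : 0 ≤ Y) (hB : 0 ≤ B)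
    (h1 : Y ≤ X + B) (h2 : X ≤ Y + B) :
    (Y ^ (p - 1) - X ^ (p - 1)) * (Y ^ 2 - X ^ 2) ≤
      2 * p * 2 ^ (p - 1) * (X ^ (p - 1) * B ^ 2 + B ^ (p + 1)) := by
  have hBp : B ^ (p + 1) = B ^ (p - 1) * B ^ 2 := by
    rw [← Real.rpow_natCast B 2, ← Real.rpow_add' hB (by push_cast; linarith)]
    congr 1; push_cast; ring
  have key : ∀ m M : ℝ, 0 ≤ m → m ≤ M → M ≤ X + B → M - m ≤ B →
      (M ^ (p - 1) - m ^ (p - 1)) * (M ^ 2 - m ^ 2) ≤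
      2 * p * 2 ^ (p - 1) * (X ^ (p - 1) * B ^ 2 + B ^ (p + 1)) := by
    intro m M hm hmM hM hd
    have hM0 := hm.trans hmM
    have hd0 := sub_nonneg.2 hmM
    calc _ ≤ 2 * p * M ^ (p - 1) * (M - m) ^ 2 := tb_prod p hp m M hm hmM
      _ ≤ 2 * p * (2 ^ (p - 1) * (X ^ (p - 1) + B ^ (p - 1))) * B ^ 2 := by
        gcongr
        exact tb_max _ (by linarith) X B M hX hB hM0 hM
      _ = _ := by rw [hBp]; ring
  rcases le_total X Y with k | k
  · exact key X Y hX k h1 (by linarith)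
  · have := key Y X hY k (by linarith) (by linarith)
    linarith

/-- pointwise second-order Taylor bound for z ↦ |z|^{p+1}, underlying the
remainder estimate |R_η^{(2)}(w)| ≤ C‖w‖²_{H¹} in (3-16). -/
theorem taylor_bound_abs_pow (p : ℝ) (hp : 1 < p) :
    ∃ C : ℝ, 0 < C ∧ ∀ a b : ℂ,
      |‖a + b‖ ^ (p + 1) - ‖a‖ ^ (p + 1) -
          (p + 1) * ‖a‖ ^ (p - 1) * ((starRingEnd ℂ) a * b).re| ≤
        C * (‖a‖ ^ (p - 1) * ‖b‖ ^ 2 + ‖b‖ ^ (p + 1)) := by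
  refine ⟨(p + 1) / 2 * (2 * p * 2 ^ (p - 1)) + (p + 1) / 2, by positivity, fun a b => ?_⟩
  have hre : ‖a + b‖ ^ 2 - ‖a‖ ^ 2 = 2 * ((starRingEnd ℂ) a * b).re + ‖b‖ ^ 2 := by
    simp only [← Complex.normSq_eq_norm_sq, Complex.normSq_apply, Complex.mul_re,
      Complex.add_re, Complex.add_im, Complex.conj_re, Complex.conj_im]
    ring
  have h1 := norm_add_le a b
  have h2 : ‖a‖ ≤ ‖a + b‖ + ‖b‖ := by simpa using norm_sub_le (a + b) b
  have hall := tb_all p hp ‖a‖ ‖a + b‖ ‖b‖ (norm_nonneg _) (norm_nonneg _) (norm_nonneg _) h1 h2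
  have e1 : ∀ x : ℝ, 0 ≤ x → (x ^ 2) ^ ((p + 1) / 2) = x ^ (p + 1) := by
    intro x hx
    rw [← Real.rpow_natCast x 2, ← Real.rpow_mul hx]
    congr 1; push_cast; ring
  have e2 : ∀ x : ℝ, 0 ≤ x → (x ^ 2) ^ ((p + 1) / 2 - 1) = x ^ (p - 1) := by
    intro x hx
    rw [← Real.rpow_natCast x 2, ← Real.rpow_mul hx]
    congr 1; push_cast; ring
  have u := tb_conv ((p + 1) / 2) (by linarith) (‖a‖ ^ 2) (‖a + b‖ ^ 2) (by positivity)
    (by positivity)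
  have l := tb_conv ((p + 1) / 2) (by linarith) (‖a + b‖ ^ 2) (‖a‖ ^ 2) (by positivity)
    (by positivity)
  rw [e1 _ (norm_nonneg _), e1 _ (norm_nonneg _), e2 _ (norm_nonneg _)] at u l
  have hA : 0 ≤ ‖a‖ ^ (p - 1) * ‖b‖ ^ 2 := by positivity
  have hBn : 0 ≤ ‖b‖ ^ (p + 1) := by positivity
  have hp2 : 0 ≤ (p + 1) / 2 := by linarith
  have hall2 := mul_le_mul_of_nonneg_left hall hp2
  have hR : ((starRingEnd ℂ) a * b).re = (‖a + b‖ ^ 2 - ‖a‖ ^ 2 - ‖b‖ ^ 2) / 2 := by linarith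
  have hC : 0 ≤ ((p + 1) / 2 * (2 * p * 2 ^ (p - 1)) + (p + 1) / 2) *
    (‖a‖ ^ (p - 1) * ‖b‖ ^ 2 + ‖b‖ ^ (p + 1)) := by positivity
  have hA2 := mul_nonneg hp2 hA
  have hB2 := mul_nonneg hp2 hBn
  rw [hR, abs_le]
  constructor
  · linarith
  · linarith
end
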